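/- Let P be a nonempty compact convex subset of ℝⁿ and let f, g : ℝⁿ → ℝ be convex differentiable functions, F = f + g. A point x⋆ ∈ P is a minimizer of F over P if and only if x⋆ is a minimizer over P of the partially linearized function s ↦ ⟨∇f(x⋆), s − x⋆⟩ + g(s) − g(x⋆). -/

import Mathlib

open RealInnerProductSpace


theorem aux_deriv {E : Type*} [NormedAddCommGroup E] [NormedSpace ℝ E] (h : E → ℝ) (h' : E →L[ℝ] ℝ)
    (x d : E) (c : ℝ) (hd : HasFDerivAt h h' x)
    (hm : ∀ t : ℝ, 0 ≤ t → t ≤ 1 → h x ≤ h (x + t • d) + t * c) : 0 ≤ h' d + c := by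
  have h1 : HasDerivAt (fun t : ℝ => x + t • d) d 0 := by
    simpa using ((hasDerivAt_id (0 : ℝ)).smul_const d).const_add x
  have h2 : HasDerivAt (fun t : ℝ => h (x + t • d)) (h' d) 0 := by
    have hd' : HasFDerivAt h h' (x + (0 : ℝ) • d) := by simpa using hd
    exact hd'.comp_hasDerivAt (0 : ℝ) h1
  have h3 : HasDerivAt (fun t : ℝ => h (x + t • d) + t * c) (h' d + c) 0 := by
    have h4 : HasDerivAt (fun t : ℝ => t * c) c 0 := by
      simpa using (hasDerivAt_id (0 : ℝ)).mul_const c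
    exact h2.add h4
  have hmin : IsMinOn (fun t : ℝ => h (x + t • d) + t * c) (Set.Icc 0 1) 0 := by
    intro t ht
    simpa using hm t ht.1 ht.2
  have hy : (1 : ℝ) ∈ posTangentConeAt (Set.Icc (0 : ℝ) 1) 0 := by
    apply mem_posTangentConeAt_of_segment_subset
    simp [segment_eq_Icc]
  simpa using hmin.localize.hasFDerivWithinAt_nonneg h3.hasFDerivAt.hasFDerivWithinAt hy

theorem aux_conv {E : Type*} [NormedAddCommGroup E] [NormedSpace ℝ E] (h : E → ℝ)
    (hc : ConvexOn ℝ Set.univ h) (x s : E) (t : ℝ) (h0 : 0 ≤ t) (h1 : t ≤ 1) :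
    h (x + t • (s - x)) ≤ h x + t * (h s - h x) := by
  have := hc.2 (Set.mem_univ x) (Set.mem_univ s) (sub_nonneg.2 h1) h0 (by ring)
  have e : (1 - t) • x + t • s = x + t • (s - x) := by module
  rw [e] at this
  simp only [smul_eq_mul] at this
  linarith

/-- `x⋆ ∈ P` minimizes `F = f + g` over the nonempty compact convex set `P`
iff it minimizes the partially linearized function `s ↦ ⟪∇f x⋆, s - x⋆⟫ + g s - g x⋆` over `P`. -/
theorem stmt_0 (n : ℕ) (P : Set (EuclideanSpace ℝ (Fin n)))
    (hPne : P.Nonempty) (hPcpt : IsCompact P) (hPconv : Convex ℝ P)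
    (f g : EuclideanSpace ℝ (Fin n) → ℝ)
    (hfconv : ConvexOn ℝ Set.univ f) (hgconv : ConvexOn ℝ Set.univ g)
    (hfdiff : Differentiable ℝ f) (hgdiff : Differentiable ℝ g)
    (xstar : EuclideanSpace ℝ (Fin n)) (hxstar : xstar ∈ P) :
    IsMinOn (fun x => f x + g x) P xstar ↔
      IsMinOn (fun s => ⟪gradient f xstar, s - xstar⟫ + g s - g xstar) P xstar := by
  have hF : HasFDerivAt f (InnerProductSpace.toDual ℝ _ (gradient f xstar)) xstar :=
    (hfdiff xstar).hasGradientAt.hasFDerivAt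
  constructor
  · intro hm s hs
    have key := aux_deriv f _ xstar (s - xstar) (g s - g xstar) hF (by
      intro t h0 h1
      have a := aux_conv g hgconv xstar s t h0 h1
      have hin : xstar + t • (s - xstar) ∈ P := hPconv.add_smul_sub_mem hxstar hs ⟨h0, h1⟩
      have b : f xstar + g xstar ≤ f (xstar + t • (s - xstar)) + g (xstar + t • (s - xstar)) :=
        hm hin
      linarith)
    simp only [InnerProductSpace.toDual_apply_apply] at key
    simp only [Set.mem_setOf_eq, sub_self, inner_zero_right]
    linarith
  · intro hm s hs
    have key := aux_deriv (-f) _ xstar (s - xstar) (f s - f xstar) hF.neg (by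
      intro t h0 h1
      have a := aux_conv f hfconv xstar s t h0 h1
      simp only [Pi.neg_apply]
      linarith)
    simp only [ContinuousLinearMap.neg_apply, InnerProductSpace.toDual_apply_apply] at key
    have b := hm hs
    simp only [Set.mem_setOf_eq, sub_self, inner_zero_right] at b ⊢
    linarith
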